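/- For each integer h ≥ 2 there exists a real constant γ_h > 1 such that a_h(n)/b_h(n) → γ_h as n → ∞; in particular there is an integer N_h > 0 such that a_h(n) ≥ b_h(n) for all n > N_h. -/

import Mathlib

open Finset

/-- The number of parts of the partition `P` that are greater than `j`;
this is the length of column `j` (0-indexed) of the Ferrers diagram,
i.e. the conjugate part `λ'_{j+1}`. -/
def colLen {n : ℕ} (P : Nat.Partition n) (j : ℕ) : ℕ :=
  (P.parts.filter (fun p => j < p)).card

/-- The length of row `i` (0-indexed) of the Ferrers diagram of `P`,
i.e. the `(i+1)`-st largest part `λ_{i+1}` (or `0` if there is none). -/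
def rowLen {n : ℕ} (P : Nat.Partition n) (i : ℕ) : ℕ :=
  ((Finset.range (n + 1)).filter (fun j => i < colLen P j)).card

/-- The number of cells of the Ferrers diagram of `P` whose hook number
`(λ_i − j) + (λ'_j − i) + 1` (1-indexed) equals `h`. -/
def hookCount {n : ℕ} (P : Nat.Partition n) (h : ℕ) : ℕ :=
  (((Finset.range (n + 1)) ×ˢ (Finset.range (n + 1))).filter
    (fun ij => ij.2 < rowLen P ij.1 ∧
      rowLen P ij.1 + colLen P ij.2 = h + ij.1 + ij.2 + 1)).card

/-- `a h n`: the total number of hooks of length `h` among partitions of `n` into odd parts. -/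
def hookOdd (h n : ℕ) : ℕ := ∑ P ∈ Nat.Partition.odds n, hookCount P h

/-- `b h n`: the total number of hooks of length `h` among partitions of `n` into distinct parts. -/
def hookDistinct (h n : ℕ) : ℕ := ∑ P ∈ Nat.Partition.distincts n, hookCount P h

section PartitionCounts

open Classical in
/-- The number of partitions of `n` whose multiset of parts satisfies `Φ`. -/
noncomputable def partCount (Φ : Multiset ℕ → Prop) (n : ℕ) : ℕ :=
  #{P : n.Partition | Φ P.parts}

lemma partCount_congr {Φ Ψ : Multiset ℕ → Prop} (h : ∀ m, Φ m ↔ Ψ m) (n : ℕ) :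
    partCount Φ n = partCount Ψ n := by
  rw [show Φ = Ψ from funext fun m => propext (h m)]

lemma partCount_mono {Φ Ψ : Multiset ℕ → Prop} (h : ∀ m, Φ m → Ψ m) (n : ℕ) :
    partCount Φ n ≤ partCount Ψ n :=
  card_le_card fun P => by simpa using h P.parts

lemma partCount_eq_zero {Φ : Multiset ℕ → Prop} (h : ∀ m, ¬ Φ m) (n : ℕ) :
    partCount Φ n = 0 := by
  simp [partCount, h]

lemma partCount_mem (Φ : Multiset ℕ → Prop) {p : ℕ} (hp : 1 ≤ p) (n : ℕ) :
    partCount (fun m => p ∈ m ∧ Φ m) n =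
      if p ≤ n then partCount (fun m => Φ (p ::ₘ m)) (n - p) else 0 := by
  classical
  split_ifs with h
  · rw [partCount, partCount, ← Fintype.card_subtype, ← Fintype.card_subtype]
    let e := Nat.Partition.partitionWithPartEquiv hp h
    refine Fintype.card_congr
      ((Equiv.subtypeSubtypeEquivSubtypeInter (fun P : n.Partition => p ∈ P.parts)
        (fun P => Φ P.parts)).symm.trans (e.subtypeEquiv fun P => ?_))
    simp [e, Multiset.cons_erase P.2]
  · simp only [partCount, card_eq_zero, filter_eq_empty_iff, mem_univ, true_implies, not_and]
    exact fun P hP => absurd (P.le_of_mem_parts hP) h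

lemma partCount_split (Φ : Multiset ℕ → Prop) {p : ℕ} (hp : 1 ≤ p) (n : ℕ) :
    partCount Φ n = partCount (fun m => p ∉ m ∧ Φ m) n +
      if p ≤ n then partCount (fun m => Φ (p ::ₘ m)) (n - p) else 0 := by
  classical
  rw [← partCount_mem Φ hp, partCount, partCount, partCount,
    ← card_filter_add_card_filter_not (s := {P : n.Partition | Φ P.parts})
      (fun P => p ∉ P.parts), filter_filter, filter_filter]
  simp [and_comm]

/-- The number of partitions of `n` into distinct parts. -/
def distinctsCount (n : ℕ) : ℕ := #(Nat.Partition.distincts n)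

lemma partCount_nodup (n : ℕ) :
    partCount Multiset.Nodup n = distinctsCount n := by
  rw [partCount, distinctsCount, Nat.Partition.distincts]
  congr!

lemma partCount_odd (n : ℕ) :
    partCount (fun m => ∀ i ∈ m, ¬ Even i) n = distinctsCount n := by
  rw [distinctsCount, ← Nat.Partition.card_odds_eq_card_distincts]
  simp [partCount, Nat.Partition.odds, Nat.Partition.restricted]

lemma distinctsCount_mono : Monotone distinctsCount := by
  refine monotone_nat_of_le_succ fun n => ?_
  simp only [← partCount_odd]
  rw [partCount_split _ le_rfl (n + 1)]
  simp

/-- The number of partitions of integers `≤ n` into distinct parts. -/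
def distinctsSum (n : ℕ) : ℕ := ∑ m ∈ range (n + 1), distinctsCount m

lemma two_pow_sqrt_le_distinctsSum (n : ℕ) : 2 ^ n.sqrt ≤ distinctsSum n := by
  simp only [distinctsSum, distinctsCount]
  rw [← card_sigma, ← Nat.add_sub_cancel (n := n.sqrt) (m := 1), ← Nat.card_Icc,
    ← card_powerset]
  have hsum : ∀ B ∈ (Icc 1 n.sqrt).powerset, B.val.sum ≤ n := fun B hB => by
    rw [mem_powerset] at hB
    calc B.val.sum = ∑ i ∈ B, i := by rw [sum_eq_multiset_sum, Multiset.map_id']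
      _ ≤ ∑ i ∈ Icc 1 n.sqrt, i := sum_le_sum_of_subset hB
      _ ≤ ∑ i ∈ Icc 1 n.sqrt, n.sqrt := sum_le_sum fun i hi => (mem_Icc.1 hi).2
      _ ≤ n := by simpa using Nat.sqrt_le n
  refine card_le_card_of_injOn
    (fun B => ⟨B.val.sum, Nat.Partition.ofSums B.val.sum B.val rfl⟩) ?_ ?_
  · intro B hB
    simp only [coe_sigma, Set.mem_sigma_iff, mem_coe, mem_range, Nat.lt_succ_iff]
    refine ⟨hsum B hB, ?_⟩
    simp only [Nat.Partition.distincts, mem_filter, mem_univ, true_and]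
    exact B.nodup.filter _
  · intro B hB C hC h
    have key : ∀ D ∈ (Icc 1 n.sqrt).powerset, D.val.filter (· ≠ 0) = D.val := fun D hD => by
      rw [Multiset.filter_eq_self]
      intro a ha
      have := mem_Icc.1 (mem_powerset.1 hD ha)
      omega
    have h2 := congrArg (fun x : Σ j, Nat.Partition j => x.2.parts) h
    simp only [Nat.Partition.ofSums_parts] at h2
    rw [key B hB, key C hC] at h2
    exact Finset.val_injective h2

lemma sum_card_parts_le_distinctsSum (n c : ℕ) :
    ∑ P ∈ Nat.Partition.distincts (n + (c + 1)), #{a ∈ P.parts.toFinset | c + 1 ≤ a} ≤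
      distinctsSum n := by
  classical
  have h1 : ∀ P ∈ Nat.Partition.distincts (n + (c + 1)),
      #{a ∈ P.parts.toFinset | c + 1 ≤ a} =
        ∑ a ∈ Icc (c + 1) (n + (c + 1)), if a ∈ P.parts then 1 else 0 := fun P _ => by
    rw [sum_boole, Nat.cast_id]
    congr 1
    ext a
    simp only [mem_filter, Multiset.mem_toFinset, mem_Icc]
    exact ⟨fun h => ⟨⟨h.2, P.le_of_mem_parts h.1⟩, h.1⟩, fun h => ⟨h.2, h.1.1⟩⟩
  rw [sum_congr rfl h1, sum_comm, distinctsSum, ← sum_range_reflect]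
  have h2 : ∀ a ∈ Icc (c + 1) (n + (c + 1)),
      (∑ P ∈ Nat.Partition.distincts (n + (c + 1)), if a ∈ P.parts then 1 else 0) ≤
        distinctsCount (n + (c + 1) - a) := fun a ha => by
    rw [mem_Icc] at ha
    calc _ = partCount (fun m => a ∈ m ∧ m.Nodup) (n + (c + 1)) := by
          rw [sum_boole, Nat.cast_id, partCount, Nat.Partition.distincts, filter_filter]
          congr 1
          ext P
          simp [and_comm]
      _ ≤ _ := by
          rw [partCount_mem _ (by omega), if_pos ha.2, ← partCount_nodup]
          exact partCount_mono (fun m hm => (Multiset.nodup_cons.1 hm).2) _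
  refine (sum_le_sum h2).trans (le_of_eq ?_)
  rw [show Icc (c + 1) (n + (c + 1)) = Ico (c + 1) (n + (c + 1) + 1) by ext; simp,
    sum_Ico_eq_sum_range]
  refine sum_congr (by congr 1; omega) fun i _ => ?_
  rw [show n + (c + 1) - (c + 1 + i) = n + 1 - 1 - i by omega]

lemma card_few_parts_le (T N : ℕ) :
    #{P ∈ Nat.Partition.distincts N | P.parts.card < T} ≤ T * (N + 1) ^ T := by
  classical
  calc _ ≤ #((range T).biUnion fun i => powersetCard i (range (N + 1))) := by
        refine card_le_card_of_injOn (fun P => P.parts.toFinset) ?_ ?_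
        · intro P hP
          simp only [coe_filter, Nat.Partition.distincts, mem_filter, mem_univ, true_and,
            Set.mem_ofPred_eq] at hP
          simp only [coe_biUnion, Set.mem_iUnion, mem_coe, mem_powersetCard, mem_range, exists_prop]
          refine ⟨_, hP.2, fun a ha => ?_, Multiset.toFinset_card_of_nodup hP.1⟩
          have := P.le_of_mem_parts (Multiset.mem_toFinset.1 ha)
          simp; omega
        · intro P hP Q hQ h
          simp only [coe_filter, Nat.Partition.distincts, mem_filter, mem_univ, true_and,
            Set.mem_ofPred_eq] at hP hQ
          have h2 := congrArg Finset.val h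
          simp only [Multiset.toFinset_val, hP.1.dedup, hQ.1.dedup] at h2
          exact Nat.Partition.ext h2
    _ ≤ ∑ i ∈ range T, #(powersetCard i (range (N + 1))) := card_biUnion_le
    _ ≤ ∑ i ∈ range T, (N + 1) ^ T := sum_le_sum fun i hi => by
        rw [card_powersetCard, card_range]
        exact (Nat.choose_le_pow _ _).trans (Nat.pow_le_pow_right (by omega) (mem_range.1 hi).le)
    _ = _ := by simp

lemma mul_distinctsCount_le (T c n : ℕ) :
    T * distinctsCount (n + (c + 1)) ≤
      distinctsSum n + T * ((T + c) * (n + (c + 1) + 1) ^ (T + c)) := by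
  classical
  rw [distinctsCount]
  set D := Nat.Partition.distincts (n + (c + 1)) with hD
  have h1 : ∑ P ∈ D with ¬ P.parts.card < T + c, T ≤ distinctsSum n := by
    refine le_trans ?_ (sum_card_parts_le_distinctsSum n c)
    refine le_trans (sum_le_sum fun P hP => ?_) (sum_le_sum_of_subset (filter_subset _ D))
    rw [mem_filter, hD, Nat.Partition.distincts, mem_filter, not_lt] at hP
    have h2 := Multiset.toFinset_card_of_nodup hP.1.2
    have h3 := card_filter_add_card_filter_not (s := P.parts.toFinset) (fun a => c + 1 ≤ a)
    have h4 : #{a ∈ P.parts.toFinset | ¬ c + 1 ≤ a} ≤ #(Icc 1 c) := card_le_card fun a ha => by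
      simp only [mem_filter, Multiset.mem_toFinset] at ha
      have := P.parts_pos ha.1
      simp; omega
    rw [Nat.card_Icc] at h4
    omega
  have h5 := card_few_parts_le (T + c) (n + (c + 1))
  rw [← hD] at h5
  rw [← card_filter_add_card_filter_not (s := D) (fun P => P.parts.card < T + c), mul_add]
  rw [sum_const, smul_eq_mul, mul_comm] at h1
  have := Nat.mul_le_mul_left T h5
  omega

end PartitionCounts

section RowSums

open Filter Topology

lemma distinctsSum_pos (n : ℕ) : (0 : ℝ) < distinctsSum n := by
  exact_mod_cast (Nat.two_pow_pos _).trans_le (two_pow_sqrt_le_distinctsSum n)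

lemma tendsto_pow_div_distinctsSum (K c : ℕ) :
    Tendsto (fun n : ℕ => ((n + c + 1 : ℕ) : ℝ) ^ K / distinctsSum n) atTop (𝓝 0) := by
  have hs : Tendsto (fun n : ℕ => n.sqrt + 1) atTop atTop := by
    refine tendsto_atTop.2 fun b => ?_
    filter_upwards [eventually_ge_atTop (b * b)] with n hn
    exact (Nat.le_sqrt.2 hn).trans (Nat.le_succ _)
  have h1 := (tendsto_pow_const_div_const_pow_of_one_lt (2 * K) (r := (2 : ℝ)) (by norm_num)).comp hs
  have h2 := h1.const_mul (((c + 1 : ℕ) : ℝ) ^ K * 2)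
  rw [mul_zero] at h2
  refine squeeze_zero (fun n => div_nonneg (by positivity) (distinctsSum_pos n).le) (fun n => ?_) h2
  have h3 : ((n + c + 1 : ℕ) : ℝ) ≤ (c + 1 : ℕ) * ((n.sqrt + 1 : ℕ) : ℝ) ^ 2 := by
    have := Nat.lt_succ_sqrt n
    have h : n + c + 1 ≤ (c + 1) * (n.sqrt + 1) ^ 2 := by
      simp only [Nat.succ_eq_add_one] at this
      nlinarith
    exact_mod_cast h
  have h4 : (2 : ℝ) ^ n.sqrt ≤ distinctsSum n := by
    exact_mod_cast two_pow_sqrt_le_distinctsSum n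
  calc ((n + c + 1 : ℕ) : ℝ) ^ K / distinctsSum n
      ≤ ((c + 1 : ℕ) * ((n.sqrt + 1 : ℕ) : ℝ) ^ 2) ^ K / 2 ^ n.sqrt := by gcongr
    _ = ((c + 1 : ℕ) : ℝ) ^ K * 2 * (((n.sqrt + 1 : ℕ) : ℝ) ^ (2 * K) / 2 ^ (n.sqrt + 1)) := by
      rw [mul_pow, ← pow_mul, pow_succ (2 : ℝ), mul_comm ((2 : ℝ) ^ n.sqrt), mul_assoc,
        mul_div_assoc]
      congr 1
      rw [← mul_div_assoc, mul_div_mul_left _ _ two_ne_zero]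

lemma tendsto_distinctsCount_div (c : ℕ) :
    Tendsto (fun n : ℕ => (distinctsCount (n + c) : ℝ) / distinctsSum n)
      atTop (𝓝 0) := by
  have key : ∀ T : ℕ, ∀ n : ℕ,
      (T + 1 : ℝ) * ((distinctsCount (n + c) : ℝ) / distinctsSum n) ≤
        1 + ((T + 1) * (T + 1 + c)) *
          (((n + (c + 1) + 1 : ℕ) : ℝ) ^ (T + 1 + c) / distinctsSum n) := fun T n => by
    have h1 := mul_distinctsCount_le (T + 1) c n
    have h2 : distinctsCount (n + c) ≤ distinctsCount (n + (c + 1)) :=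
      distinctsCount_mono (by omega)
    have h3 := (Nat.mul_le_mul_left (T + 1) h2).trans h1
    have h4 : ((T : ℝ) + 1) * distinctsCount (n + c) ≤ distinctsSum n +
        (T + 1) * ((T + 1 + c) * ((n + (c + 1) + 1 : ℕ) : ℝ) ^ (T + 1 + c)) := by
      exact_mod_cast h3
    have h5 := distinctsSum_pos n
    rw [← mul_div_assoc, ← mul_div_assoc, div_le_iff₀ h5, one_add_mul, div_mul_cancel₀ _ h5.ne',
      mul_assoc]
    exact h4
  rw [Metric.tendsto_atTop']
  intro ε hε
  obtain ⟨T, hT⟩ := exists_nat_gt (2 / ε)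
  have h1 := (tendsto_pow_div_distinctsSum (T + 1 + c) (c + 1)).const_mul
    ((T + 1 : ℝ) * (T + 1 + c))
  rw [mul_zero] at h1
  obtain ⟨N, hN⟩ := eventually_atTop.1 (h1.eventually (gt_mem_nhds one_pos))
  refine ⟨N, fun n hn => ?_⟩
  have h2 := key T n
  have h3 := hN n hn.le
  rw [Real.dist_eq, sub_zero, abs_of_nonneg (div_nonneg (by positivity) (distinctsSum_pos n).le)]
  have h4 : 2 < T * ε := by rwa [div_lt_iff₀ hε] at hT
  by_contra! hcon
  have h5 : ((T : ℝ) + 1) * ε ≤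
      (T + 1) * ((distinctsCount (n + c) : ℝ) / distinctsSum n) := by gcongr
  nlinarith

open Classical in
/-- The sum over `k` satisfying `K` of the `(n + c)`-th
coefficient of `q ^ (M * k) * ∑ X k m * q ^ m`. -/
noncomputable def rowSum (K : ℕ → Prop) (X : ℕ → ℕ → ℝ) (M c n : ℕ) : ℝ :=
  ∑ k ∈ range (n + c + 1) with K k ∧ M * k ≤ n + c, X k (n + c - M * k)

/-- All the row sums of `X` with `M + 1` in place of `M` are
asymptotic to `ℓ M` times `distinctsSum`. -/
def RowAsymptotic (K : ℕ → Prop) (X : ℕ → ℕ → ℝ) (ℓ : ℕ → ℝ) : Prop :=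
  ∀ M c, Tendsto (fun n => rowSum K X (M + 1) c n / distinctsSum n) atTop (𝓝 (ℓ M))

/-- Multiplication of the generating function of `X k` by `q ^ (k - i)`. -/
def rowShift (i : ℕ) (X : ℕ → ℕ → ℝ) (k m : ℕ) : ℝ :=
  if k - i ≤ m then X k (m - (k - i)) else 0

variable {K : ℕ → Prop} {X Y : ℕ → ℕ → ℝ} {ℓ ℓ' : ℕ → ℝ}

open Classical in
lemma of_rowSum_mem {M N k : ℕ} (hk : k ∈ {k ∈ range (N + 1) | K k ∧ M * k ≤ N}) : K k :=
  (mem_filter.1 hk).2.1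

lemma rowSum_congr (h : ∀ k, K k → ∀ m, X k m = Y k m) (M c n : ℕ) :
    rowSum K X M c n = rowSum K Y M c n :=
  sum_congr rfl fun k hk => h k (of_rowSum_mem hk) _

lemma rowSum_mono (h : ∀ k, K k → ∀ m, X k m ≤ Y k m) (M c n : ℕ) :
    rowSum K X M c n ≤ rowSum K Y M c n :=
  sum_le_sum fun k hk => h k (of_rowSum_mem hk) _

lemma RowAsymptotic.congr (hX : RowAsymptotic K X ℓ) (h : ∀ k, K k → ∀ m, Y k m = X k m)
    (hℓ : ∀ M, ℓ' M = ℓ M) : RowAsymptotic K Y ℓ' := fun M c => by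
  simp only [rowSum_congr h, hℓ]
  exact hX M c

lemma RowAsymptotic.add (hX : RowAsymptotic K X ℓ) (hY : RowAsymptotic K Y ℓ') :
    RowAsymptotic K (fun k m => X k m + Y k m) (fun M => ℓ M + ℓ' M) := fun M c => by
  simp only [rowSum, sum_add_distrib, add_div]
  exact (hX M c).add (hY M c)

lemma RowAsymptotic.sub (hX : RowAsymptotic K X ℓ) (hY : RowAsymptotic K Y ℓ') :
    RowAsymptotic K (fun k m => X k m - Y k m) (fun M => ℓ M - ℓ' M) := fun M c => by
  simp only [rowSum, sum_sub_distrib, sub_div]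
  exact (hX M c).sub (hY M c)

lemma rowAsymptotic_zero : RowAsymptotic K (fun _ _ => 0) (fun _ => 0) := fun M c => by
  simp [rowSum]

lemma rowSum_rowShift {i : ℕ} (hK : ∀ k, K k → i ≤ k) (X : ℕ → ℕ → ℝ) (M c n : ℕ) :
    rowSum K (rowShift i X) (M + 1) c n = rowSum K X (M + 2) (c + i) n := by
  classical
  simp only [rowSum, rowShift]
  rw [← sum_filter, filter_filter]
  refine sum_congr ?_ fun k hk => ?_
  · ext k
    simp only [mem_filter, mem_range]
    constructor
    · rintro ⟨h1, ⟨h2, h3⟩, h4⟩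
      have := hK k h2
      rw [show (M + 2) * k = (M + 1) * k + k by ring]
      exact ⟨by omega, h2, by omega⟩
    · rintro ⟨h1, h2, h3⟩
      have := hK k h2
      have h5 : k ≤ (M + 1) * k := Nat.le_mul_of_pos_left k (by omega)
      rw [show (M + 2) * k = (M + 1) * k + k by ring] at h3
      exact ⟨by omega, ⟨h2, by omega⟩, by omega⟩
  · simp only [mem_filter, mem_range] at hk
    have := hK k hk.2.1
    rw [show (M + 2) * k = (M + 1) * k + k by ring] at hk ⊢
    congr 1
    omega

lemma RowAsymptotic.rowShift {i : ℕ} (hX : RowAsymptotic K X ℓ) (hK : ∀ k, K k → i ≤ k) :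
    RowAsymptotic K (rowShift i X) (fun M => ℓ (M + 1)) := fun M c => by
  simp only [rowSum_rowShift hK]
  exact hX (M + 1) (c + i)

lemma RowAsymptotic.of_add_rowShift {i : ℕ} {C : ℝ} {U : ℕ → ℕ → ℝ} {u : ℕ → ℝ}
    (hK : ∀ k, K k → i ≤ k)
    (hY : RowAsymptotic K Y ℓ') (hXY : ∀ k, K k → ∀ m, X k m + _root_.rowShift i X k m = Y k m)
    (hU : RowAsymptotic K U u) (hX0 : ∀ k, K k → ∀ m, 0 ≤ X k m)
    (hXU : ∀ k, K k → ∀ m, X k m ≤ U k m) (hu : ∀ M, u M ≤ 1 / (M + 1))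
    (hℓ : ∀ M, ℓ M + ℓ (M + 1) = ℓ' M) (hℓC : ∀ M, |ℓ M| ≤ C / (M + 1)) :
    RowAsymptotic K X ℓ := by
  have hrel : ∀ M c, Tendsto (fun n => (rowSum K X (M + 1) c n / distinctsSum n - ℓ M) +
      (rowSum K X (M + 2) (c + i) n / distinctsSum n - ℓ (M + 1))) atTop (𝓝 0) := fun M c => by
    have h := (hY M c).sub_const (ℓ' M)
    rw [sub_self] at h
    refine h.congr fun n => ?_
    rw [← hℓ, ← rowSum_rowShift hK, ← rowSum_congr hXY]
    simp only [rowSum, sum_add_distrib]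
    ring
  have key : ∀ j M c : ℕ, ∀ δ : ℝ, 1 + C < (M + j + 1) * δ →
      ∀ᶠ n in atTop, |rowSum K X (M + 1) c n / distinctsSum n - ℓ M| < δ := by
    intro j
    induction j with
    | zero =>
      intro M c δ hδ
      have hM : (0 : ℝ) < M + 1 := by positivity
      have h1 : u M < δ - C / (M + 1) := by
        refine (hu M).trans_lt ?_
        rw [lt_sub_iff_add_lt, ← add_div, div_lt_iff₀ hM]
        simpa [mul_comm] using hδ
      filter_upwards [(hU M c).eventually (gt_mem_nhds h1)] with n hn
      have h2 : 0 ≤ rowSum K X (M + 1) c n / distinctsSum n :=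
        div_nonneg (sum_nonneg fun k hk => hX0 k (of_rowSum_mem hk) _) (distinctsSum_pos n).le
      have h3 : rowSum K X (M + 1) c n / distinctsSum n ≤
          rowSum K U (M + 1) c n / distinctsSum n :=
        div_le_div_of_nonneg_right (rowSum_mono hXU _ _ _) (distinctsSum_pos n).le
      have h4 := abs_sub (rowSum K X (M + 1) c n / distinctsSum n) (ℓ M)
      rw [abs_of_nonneg h2] at h4
      linarith [hℓC M]
    | succ j ih =>
      intro M c δ hδ
      have hM : (0 : ℝ) < M + j + 2 := by positivity
      have h1 : (1 + C) / (M + j + 2) < δ := by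
        rw [div_lt_iff₀ hM]
        push_cast at hδ
        linarith
      obtain ⟨δ', h2, h3⟩ := exists_between h1
      rw [div_lt_iff₀ hM] at h2
      have h4 := ih (M + 1) (c + i) δ' (by push_cast; linarith)
      have h5 := (hrel M c).eventually (Metric.ball_mem_nhds 0 (sub_pos.2 h3))
      filter_upwards [h4, h5] with n h6 h7
      rw [dist_zero_right, Real.norm_eq_abs] at h7
      have h8 := abs_sub ((rowSum K X (M + 1) c n / distinctsSum n - ℓ M) +
        (rowSum K X (M + 2) (c + i) n / distinctsSum n - ℓ (M + 1)))
        (rowSum K X (M + 2) (c + i) n / distinctsSum n - ℓ (M + 1))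
      rw [add_sub_cancel_right] at h8
      have h9 : |rowSum K X (M + 2) (c + i) n / distinctsSum n - ℓ (M + 1)| < δ' := h6
      linarith
  intro M c
  rw [Metric.tendsto_nhds]
  intro δ hδ
  obtain ⟨j, hj⟩ := exists_nat_gt ((1 + C) / δ)
  rw [div_lt_iff₀ hδ] at hj
  refine key j M c δ ?_
  nlinarith [mul_nonneg (Nat.cast_nonneg (α := ℝ) M) hδ.le]

lemma distinctsSum_succ (n : ℕ) :
    distinctsSum (n + 1) = distinctsSum n + distinctsCount (n + 1) :=
  sum_range_succ _ _

lemma distinctsSum_mono : Monotone distinctsSum :=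
  monotone_nat_of_le_succ fun n => by simp [distinctsSum_succ]

lemma distinctsSum_add_le (n d : ℕ) :
    distinctsSum (n + d) ≤ distinctsSum n + d * distinctsCount (n + d) := by
  induction d with
  | zero => simp
  | succ d ih =>
    have h := Nat.mul_le_mul_left d (distinctsCount_mono (show n + d ≤ n + d + 1 by omega))
    rw [← add_assoc, distinctsSum_succ, add_mul]
    omega

lemma le_distinctsSum_add (n d : ℕ) :
    distinctsSum n + d * distinctsCount n ≤ distinctsSum (n + d) := by
  induction d with
  | zero => simp
  | succ d ih =>
    have h := distinctsCount_mono (show n ≤ n + d + 1 by omega)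
    rw [← add_assoc, distinctsSum_succ, add_mul]
    omega

lemma sum_progression_bounds {D : ℕ} (hD : 0 < D) (N : ℕ) :
    distinctsSum N ≤ D * ∑ t ∈ range (N / D + 1), distinctsCount (N - D * t) ∧
    D * ∑ t ∈ range (N / D + 1), distinctsCount (N - D * t) ≤
      distinctsSum N + D * distinctsCount N := by
  induction N using Nat.strong_induction_on with
  | _ N ih =>
    rcases lt_or_ge N D with h | h
    · rw [Nat.div_eq_of_lt h]
      simp only [zero_add, range_one, sum_singleton, mul_zero, Nat.sub_zero]
      refine ⟨?_, Nat.le_add_left _ _⟩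
      have h1 := distinctsSum_add_le 0 N
      have h2 : distinctsSum 0 ≤ distinctsCount N := by
        simpa [distinctsSum] using distinctsCount_mono (Nat.zero_le N)
      rw [zero_add] at h1
      calc _ ≤ (N + 1) * distinctsCount N := by rw [add_mul]; omega
        _ ≤ _ := Nat.mul_le_mul_right _ h
    · obtain ⟨N, rfl⟩ := Nat.exists_eq_add_of_le' h
      have h1 := ih N (by omega)
      rw [Nat.add_div_right _ hD, sum_range_succ']
      have h2 : ∀ t, N + D - D * (t + 1) = N - D * t := fun t => by rw [mul_add]; omega
      simp only [h2, mul_zero, Nat.sub_zero]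
      rw [mul_add]
      have h3 := distinctsSum_add_le N D
      have h4 := le_distinctsSum_add N D
      omega

lemma rowAsymptotic_distinctsCount {b d : ℕ} (hd : 0 < d) (hK : ∀ k, K k ↔ ∃ t, k = b + d * t) :
    RowAsymptotic K (fun _ m => distinctsCount m) (fun M => 1 / (d * (M + 1))) := by
  classical
  intro M c
  set D := (M + 1) * d with hD
  have hD0 : 0 < D := by positivity
  have hDR : (0 : ℝ) < D := by exact_mod_cast hD0
  set B := (M + 1) * b with hB
  have hsum : ∀ n, B ≤ n → rowSum K (fun _ m => (distinctsCount m : ℝ)) (M + 1) c n =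
      ((∑ t ∈ range ((n + c - B) / D + 1), distinctsCount (n + c - B - D * t) : ℕ) :
        ℝ) := fun n hn => by
    rw [rowSum, Nat.cast_sum]
    symm
    refine sum_bij (fun t _ => b + d * t) (fun t ht => ?_) (fun t _ t' _ h => ?_)
      (fun k hk => ?_) (fun t ht => ?_)
    · rw [mem_range, Nat.lt_succ_iff, Nat.le_div_iff_mul_le hD0] at ht
      have h1 : (M + 1) * (b + d * t) = B + t * D := by rw [hB, hD]; ring
      have h2 : b + d * t ≤ (M + 1) * (b + d * t) := Nat.le_mul_of_pos_left _ (by omega)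
      simp only [mem_filter, mem_range]
      exact ⟨by omega, (hK _).2 ⟨t, rfl⟩, by omega⟩
    · exact Nat.eq_of_mul_eq_mul_left hd (by omega)
    · simp only [mem_filter, mem_range] at hk
      obtain ⟨t, rfl⟩ := (hK k).1 hk.2.1
      have h1 : (M + 1) * (b + d * t) = B + t * D := by rw [hB, hD]; ring
      refine ⟨t, ?_, rfl⟩
      rw [mem_range, Nat.lt_succ_iff, Nat.le_div_iff_mul_le hD0]
      omega
    · have h1 : (M + 1) * (b + d * t) = B + D * t := by rw [hB, hD]; ring
      rw [h1, Nat.sub_add_eq]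
  have hbound : ∀ n, B ≤ n →
      |D * rowSum K (fun _ m => (distinctsCount m : ℝ)) (M + 1) c n - distinctsSum n| ≤
        ((c + B + D : ℕ) : ℝ) * distinctsCount (n + c) := fun n hn => by
    obtain ⟨h1, h2⟩ := sum_progression_bounds hD0 (n + c - B)
    rw [hsum n hn]
    generalize ∑ t ∈ range ((n + c - B) / D + 1), distinctsCount (n + c - B - D * t) = f
      at h1 h2
    have h3 := distinctsSum_add_le n c
    have h4 := distinctsSum_add_le (n + c - B) B
    rw [Nat.sub_add_cancel (by omega)] at h4
    have h5 := distinctsSum_mono (show n ≤ n + c by omega)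
    have h6 := distinctsSum_mono (show n + c - B ≤ n + c by omega)
    have h7 := Nat.mul_le_mul_left D (distinctsCount_mono (show n + c - B ≤ n + c by omega))
    have h8 : D * f ≤ distinctsSum n + (c + B + D) * distinctsCount (n + c) := by
      rw [add_mul, add_mul]
      omega
    have h9 : distinctsSum n ≤ D * f + (c + B + D) * distinctsCount (n + c) := by
      rw [add_mul, add_mul]
      omega
    rw [abs_le]
    constructor
    · have : (distinctsSum n : ℝ) ≤
          D * f + ((c + B + D : ℕ) : ℝ) * distinctsCount (n + c) := by exact_mod_cast h9
      linarith
    · have : (D * f : ℝ) ≤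
          distinctsSum n + ((c + B + D : ℕ) : ℝ) * distinctsCount (n + c) := by
        exact_mod_cast h8
      linarith
  have hlim : Tendsto (fun n =>
      (D * rowSum K (fun _ m => (distinctsCount m : ℝ)) (M + 1) c n - distinctsSum n) /
        distinctsSum n) atTop (𝓝 0) := by
    have h := (tendsto_distinctsCount_div c).const_mul ((c + B + D : ℕ) : ℝ)
    rw [mul_zero] at h
    refine squeeze_zero_norm' ?_ h
    filter_upwards [eventually_ge_atTop B] with n hn
    rw [Real.norm_eq_abs, abs_div, abs_of_pos (distinctsSum_pos n), ← mul_div_assoc]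
    exact div_le_div_of_nonneg_right (hbound n hn) (distinctsSum_pos n).le
  have h := (hlim.add_const 1).div_const (D : ℝ)
  rw [zero_add, hD, mul_comm (M + 1)] at h
  push_cast at h
  refine h.congr fun n => ?_
  have := distinctsSum_pos n
  have hd' : (0 : ℝ) < d := by exact_mod_cast hd
  field_simp
  ring

end RowSums

section Hooks

/-- The number of elements of `m` in the interval `[k - s, k)`. -/
def windowCount (s k : ℕ) (m : Multiset ℕ) : ℕ :=
  (m.filter fun p => k ≤ p + s ∧ p < k).card

lemma windowCount_zero (k : ℕ) (m : Multiset ℕ) : windowCount 0 k m = 0 := by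
  simp [windowCount, Multiset.filter_eq_nil]

lemma windowCount_cons_self (s k : ℕ) (m : Multiset ℕ) :
    windowCount s k (k ::ₘ m) = windowCount s k m := by
  simp [windowCount]

lemma windowCount_cons_of_add_lt {s k p : ℕ} (h : p + s < k) (m : Multiset ℕ) :
    windowCount s k (p ::ₘ m) = windowCount s k m := by
  rw [windowCount, Multiset.filter_cons_of_neg _ (by omega), windowCount]

lemma windowCount_succ_cons {s k : ℕ} (h : s + 1 ≤ k) (m : Multiset ℕ) :
    windowCount (s + 1) k ((k - (s + 1)) ::ₘ m) = windowCount (s + 1) k m + 1 := by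
  rw [windowCount, Multiset.filter_cons_of_pos _ (by omega), Multiset.card_cons, windowCount]

lemma windowCount_succ_of_notMem {s k : ℕ} {m : Multiset ℕ} (h : k - (s + 1) ∉ m) :
    windowCount (s + 1) k m = windowCount s k m := by
  rw [windowCount, windowCount]
  congr 1
  refine Multiset.filter_congr fun p hp => ?_
  have : p ≠ k - (s + 1) := fun h' => h (h' ▸ hp)
  omega

variable {n : ℕ} (P : n.Partition)

lemma colLen_anti {i j : ℕ} (h : i ≤ j) : colLen P j ≤ colLen P i :=
  Multiset.card_le_card (Multiset.monotone_filter_right _ fun _ hp => h.trans_lt hp)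

lemma lt_of_colLen_pos {j : ℕ} (h : 0 < colLen P j) : j < n := by
  obtain ⟨p, hp⟩ := Multiset.card_pos_iff_exists_mem.1 h
  rw [Multiset.mem_filter] at hp
  exact hp.2.trans_le (P.le_of_mem_parts hp.1)

lemma lt_rowLen_iff (i j : ℕ) : j < rowLen P i ↔ i < colLen P j := by
  constructor
  · intro h
    by_contra hc
    refine absurd h (not_lt.2 ?_)
    rw [rowLen, ← card_range j]
    refine card_le_card fun l hl => ?_
    rw [mem_filter] at hl
    rw [mem_range]
    by_contra hlj
    have := colLen_anti P (not_lt.1 hlj)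
    omega
  · intro h
    have hj := lt_of_colLen_pos P (by omega : 0 < colLen P j)
    rw [← Nat.succ_le_iff, ← card_range j.succ, rowLen]
    refine card_le_card fun l hl => ?_
    rw [mem_range] at hl
    rw [mem_filter, mem_range]
    have := colLen_anti P (Nat.lt_succ_iff.1 hl)
    omega

lemma card_filter_lt_eq (k : ℕ) (m : Multiset ℕ) (s : ℕ) (h : s + 1 ≤ k) :
    (m.filter fun p => k - s - 1 < p).card =
      windowCount s k m + m.count k + (m.filter fun p => k < p).card := by
  induction m using Multiset.induction_on with
  | empty => simp [windowCount]
  | cons a m ih =>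
    simp only [windowCount, Multiset.filter_cons, Multiset.count_cons, Multiset.card_add] at ih ⊢
    rw [ih]
    split_ifs <;> simp <;> omega

lemma colLen_eq {s k : ℕ} (h : s + 1 ≤ k) :
    colLen P (k - s - 1) = windowCount s k P.parts + P.parts.count k + colLen P k :=
  card_filter_lt_eq k P.parts s h

lemma hookCount_eq (h : ℕ) :
    hookCount P h = ∑ s ∈ range h, #{k ∈ Icc (s + 1) n |
      windowCount s k P.parts ≤ h - 1 - s ∧
      h - 1 - s < windowCount s k P.parts + P.parts.count k} := by
  rw [← card_sigma, hookCount]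
  have hcell : ∀ i j, j < rowLen P i → rowLen P i + colLen P j = h + i + j + 1 →
      rowLen P i ≤ n ∧ i < P.parts.count (rowLen P i) + colLen P (rowLen P i) ∧
      colLen P (rowLen P i) ≤ i ∧ windowCount (rowLen P i - j - 1) (rowLen P i) P.parts +
        P.parts.count (rowLen P i) + colLen P (rowLen P i) + rowLen P i = h + i + j + 1 := by
    intro i j h1 h2
    have h3 := (lt_rowLen_iff P i (rowLen P i - 1)).1 (by omega)
    have h4 := lt_of_colLen_pos P (by omega : 0 < colLen P (rowLen P i - 1))
    have h5 := (lt_rowLen_iff P i (rowLen P i)).not.1 (lt_irrefl _)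
    have h6 := colLen_eq P (s := 0) (k := rowLen P i) (by omega)
    have h7 := colLen_eq P (s := rowLen P i - j - 1) (k := rowLen P i) (by omega)
    rw [show rowLen P i - (rowLen P i - j - 1) - 1 = j by omega] at h7
    rw [windowCount_zero, Nat.sub_zero] at h6
    omega
  refine card_bij (fun ij _ => ⟨rowLen P ij.1 - ij.2 - 1, rowLen P ij.1⟩) ?_ ?_ ?_
  · rintro ⟨i, j⟩ hij
    simp only [mem_filter, mem_product, mem_range] at hij
    have := hcell i j hij.2.1 hij.2.2
    simp only [mem_sigma, mem_range, mem_filter, mem_Icc]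
    omega
  · rintro ⟨i, j⟩ hij ⟨i', j'⟩ hij' he
    simp only [mem_filter, mem_product, mem_range] at hij hij'
    simp only [Sigma.mk.injEq, heq_eq_eq] at he
    have hj : j = j' := by omega
    subst hj
    rw [Prod.mk.injEq]
    omega
  · rintro ⟨s, k⟩ hsk
    simp only [mem_sigma, mem_range, mem_filter, mem_Icc] at hsk
    obtain ⟨h1, ⟨h2, h3⟩, h4, h5⟩ := hsk
    have h6 := colLen_eq P h2
    have h7 := colLen_eq P (s := 0) (k := k) (by omega)
    rw [windowCount_zero, Nat.sub_zero] at h7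
    set i := colLen P (k - s - 1) + s - h with hi
    have h8 : rowLen P i = k := by
      have h9 := (lt_rowLen_iff P i (k - 1)).2 (by omega)
      have h10 := (lt_rowLen_iff P i k).not.2 (by omega)
      omega
    have h11 : i ≤ n := by
      have h12 : colLen P (k - 1) ≤ n := by
        refine (Multiset.card_le_card (Multiset.filter_le _ _)).trans ?_
        have h13 := Multiset.card_nsmul_le_sum (s := P.parts) (a := 1) fun p hp => P.parts_pos hp
        rwa [P.parts_sum, smul_eq_mul, mul_one] at h13
      omega
    refine ⟨(i, k - s - 1), ?_, ?_⟩
    · simp only [mem_filter, mem_product, mem_range, h8]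
      omega
    · simp only [h8, Sigma.mk.injEq, heq_eq_eq, and_true]
      omega

open Classical in
lemma sum_hookCount_eq (A : Multiset ℕ → Prop) (h n : ℕ) :
    ∑ P : n.Partition with A P.parts, hookCount P h = ∑ s ∈ range h, ∑ k ∈ Icc (s + 1) n,
      partCount (fun m => A (k ::ₘ m) ∧ windowCount s k m ≤ h - 1 - s ∧
        h - 1 - s ≤ windowCount s k m + m.count k) (n - k) := by
  simp only [hookCount_eq]
  rw [sum_comm]
  refine sum_congr rfl fun s _ => ?_
  simp only [card_filter]
  rw [sum_comm]
  refine sum_congr rfl fun k hk => ?_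
  rw [mem_Icc] at hk
  have h1 := partCount_mem (fun m => A m ∧ windowCount s k m ≤ h - 1 - s ∧
    h - 1 - s < windowCount s k m + m.count k) (p := k) (by omega) n
  rw [if_pos hk.2] at h1
  rw [← card_filter, filter_filter]
  refine Eq.trans ?_ (h1.trans (partCount_congr (fun m => ?_) _))
  · rw [partCount]
    congr 1
    ext P
    simp only [mem_filter, mem_univ, true_and]
    refine ⟨fun hP => ⟨?_, hP⟩, fun hP => hP.2⟩
    rw [← Multiset.one_le_count_iff_mem]
    omega
  · rw [windowCount_cons_self, Multiset.count_cons_self]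
    simp only [← add_assoc, Nat.lt_succ_iff]

end Hooks

section OddPatterns

/-- The multisets of odd numbers that, with one part `k` added, have a hook of length `s + 1 + H`
whose row has length `k` and whose arm is `s`. -/
def OddHook (s H k : ℕ) (m : Multiset ℕ) : Prop :=
  (∀ i ∈ m, ¬ Even i) ∧ windowCount s k m ≤ H ∧ H ≤ windowCount s k m + m.count k

/-- The asymptotic proportion of the patterns `OddHook s H`, where `t = s / 2`. -/
noncomputable def oddLimit (t H M : ℕ) : ℝ :=
  ((t + H).factorial * (H + M).factorial : ℝ) / (2 * (H.factorial * (H + M + t + 1).factorial))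

lemma oddLimit_zero_zero (M : ℕ) : oddLimit 0 0 M = 1 / ((2 : ℕ) * (M + 1)) := by
  simp only [oddLimit, zero_add, add_zero, Nat.factorial_succ, Nat.factorial_zero]
  push_cast
  have : (M.factorial : ℝ) ≠ 0 := by positivity
  field_simp

lemma oddLimit_zero_succ (H M : ℕ) : oddLimit 0 (H + 1) M = oddLimit 0 H (M + 1) := by
  simp only [oddLimit, zero_add, add_zero]
  rw [show H + 1 + M = H + (M + 1) by ring]
  field_simp

lemma oddLimit_succ_zero (t M : ℕ) :
    oddLimit (t + 1) 0 M = oddLimit t 0 M - oddLimit t 0 (M + 1) := by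
  simp only [oddLimit, zero_add, add_zero, Nat.factorial_zero]
  rw [show M + (t + 1) + 1 = M + t + 1 + 1 by ring, show M + 1 + t + 1 = M + t + 1 + 1 by ring]
  simp only [Nat.factorial_succ]
  push_cast
  field_simp
  ring

lemma oddLimit_succ_succ (t H M : ℕ) : oddLimit (t + 1) (H + 1) M =
    oddLimit t (H + 1) M + oddLimit (t + 1) H (M + 1) - oddLimit t (H + 1) (M + 1) := by
  simp only [oddLimit]
  rw [show H + 1 + M + (t + 1) + 1 = H + M + t + 1 + 1 + 1 by ring,
    show H + 1 + M + t + 1 = H + M + t + 1 + 1 by ring,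
    show H + (M + 1) + (t + 1) + 1 = H + M + t + 1 + 1 + 1 by ring,
    show H + 1 + (M + 1) + t + 1 = H + M + t + 1 + 1 + 1 by ring,
    show H + 1 + (M + 1) = H + M + 1 + 1 by ring,
    show H + 1 + M = H + M + 1 by ring, show H + (M + 1) = H + M + 1 by ring,
    show t + 1 + (H + 1) = t + H + 1 + 1 by ring, show t + (H + 1) = t + H + 1 by ring,
    show t + 1 + H = t + H + 1 by ring]
  simp only [Nat.factorial_succ]
  push_cast
  field_simp
  ring

lemma oddLimit_at_zero (t H : ℕ) : oddLimit t H 0 = 1 / (2 * (t + H + 1)) := by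
  simp only [oddLimit, add_zero]
  rw [show H + t + 1 = t + H + 1 by ring, Nat.factorial_succ (t + H)]
  push_cast
  field_simp

lemma partCount_oddHook_zero_succ {k : ℕ} (hk : ¬ Even k) (hk1 : 1 ≤ k) (H n : ℕ) :
    (partCount (OddHook 0 (H + 1) k) n : ℝ) =
      rowShift 0 (fun k m => (partCount (OddHook 0 H k) m : ℝ)) k n := by
  rw [partCount_split _ hk1, partCount_eq_zero, zero_add, rowShift, Nat.sub_zero]
  · split_ifs
    · rw [partCount_congr fun m => ?_]
      simp [OddHook, windowCount_zero, Nat.not_even_iff_odd.1 hk]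
    · simp
  · rintro m ⟨h1, -, -, h2⟩
    rw [windowCount_zero, Multiset.count_eq_zero.2 h1] at h2
    omega

lemma oddHook_cons {s H k : ℕ} (hs : s + 2 ≤ k) (hp : ¬ Even (k - (s + 1))) (m : Multiset ℕ) :
    OddHook s H k ((k - (s + 1)) ::ₘ m) ↔ OddHook s H k m := by
  rw [OddHook, windowCount_cons_of_add_lt (by omega), Multiset.count_cons_of_ne (by omega), OddHook]
  simp [Nat.not_even_iff_odd.1 hp]

lemma oddHook_succ_cons {s H k : ℕ} (hs : s + 2 ≤ k) (hp : ¬ Even (k - (s + 1)))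
    (m : Multiset ℕ) :
    OddHook (s + 1) (H + 1) k ((k - (s + 1)) ::ₘ m) ↔ OddHook (s + 1) H k m := by
  rw [OddHook, windowCount_succ_cons (by omega), Multiset.count_cons_of_ne (by omega), OddHook,
    add_right_comm]
  simp [Nat.not_even_iff_odd.1 hp]

lemma not_oddHook_succ_zero_cons {s k : ℕ} (hs : s + 2 ≤ k) (m : Multiset ℕ) :
    ¬ OddHook (s + 1) 0 k ((k - (s + 1)) ::ₘ m) := by
  rw [OddHook, windowCount_succ_cons (by omega)]
  omega

lemma notMem_and_oddHook_succ (s H k : ℕ) (m : Multiset ℕ) :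
    k - (s + 1) ∉ m ∧ OddHook (s + 1) H k m ↔ k - (s + 1) ∉ m ∧ OddHook s H k m := by
  refine and_congr_right fun h => ?_
  rw [OddHook, windowCount_succ_of_notMem h, OddHook]

lemma oddHook_succ_of_even {s k : ℕ} (hp : Even (k - (s + 1))) (H : ℕ) (m : Multiset ℕ) :
    OddHook (s + 1) H k m ↔ OddHook s H k m := by
  refine and_congr_right fun h => ?_
  rw [windowCount_succ_of_notMem fun h' => h _ h' hp]

lemma partCount_oddHook_succ_zero {s k : ℕ} (hs : s + 2 ≤ k) (hp : ¬ Even (k - (s + 1))) (n : ℕ) :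
    (partCount (OddHook (s + 1) 0 k) n : ℝ) = partCount (OddHook s 0 k) n -
      rowShift (s + 1) (fun k m => (partCount (OddHook s 0 k) m : ℝ)) k n := by
  rw [partCount_split (OddHook (s + 1) 0 k) (p := k - (s + 1)) (by omega),
    partCount_split (OddHook s 0 k) (p := k - (s + 1)) (by omega),
    partCount_congr (notMem_and_oddHook_succ s 0 k), rowShift,
    partCount_eq_zero (not_oddHook_succ_zero_cons hs), partCount_congr (oddHook_cons hs hp)]
  split_ifs <;> simp

lemma partCount_oddHook_succ_succ {s k : ℕ} (hs : s + 2 ≤ k) (hp : ¬ Even (k - (s + 1)))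
    (H n : ℕ) : (partCount (OddHook (s + 1) (H + 1) k) n : ℝ) = partCount (OddHook s (H + 1) k) n +
      rowShift (s + 1) (fun k m => (partCount (OddHook (s + 1) H k) m : ℝ)) k n -
      rowShift (s + 1) (fun k m => (partCount (OddHook s (H + 1) k) m : ℝ)) k n := by
  rw [partCount_split (OddHook (s + 1) (H + 1) k) (p := k - (s + 1)) (by omega),
    partCount_split (OddHook s (H + 1) k) (p := k - (s + 1)) (by omega),
    partCount_congr (notMem_and_oddHook_succ s (H + 1) k), rowShift, rowShift,
    partCount_congr (oddHook_succ_cons hs hp), partCount_congr (oddHook_cons hs hp)]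
  split_ifs <;> push_cast <;> ring

variable {K : ℕ → Prop} {S : ℕ}

lemma rowAsymptotic_oddHook (hK : ∀ k, K k → S + 1 ≤ k ∧ ¬ Even k)
    (hbase : RowAsymptotic K (fun _ m => (distinctsCount m : ℝ)) (oddLimit 0 0))
    (s H : ℕ) (hs : s ≤ S) :
    RowAsymptotic K (fun k m => (partCount (OddHook s H k) m : ℝ)) (oddLimit (s / 2) H) := by
  induction s generalizing H with
  | zero =>
    induction H with
    | zero =>
      refine hbase.congr (fun k _ m => ?_) fun _ => rfl
      rw [← partCount_odd, partCount_congr fun m => ?_]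
      simp [OddHook, windowCount_zero]
    | succ H ih =>
      refine (ih.rowShift (i := 0) fun _ _ => Nat.zero_le _).congr (fun k hk m => ?_)
        fun M => oddLimit_zero_succ H M
      exact partCount_oddHook_zero_succ (hK k hk).2 (by have := hK k hk; omega) H m
  | succ s ih =>
    have hi : ∀ k, K k → s + 1 ≤ k := fun k hk => by have := hK k hk; omega
    rcases Nat.even_or_odd s with he | ho
    · rw [show (s + 1) / 2 = s / 2 by grind]
      refine (ih H (by omega)).congr (fun k hk m => ?_) fun _ => rfl
      rw [partCount_congr (oddHook_succ_of_even _ H)]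
      have := hK k hk
      grind
    · rw [show (s + 1) / 2 = s / 2 + 1 by grind]
      have hp : ∀ k, K k → ¬ Even (k - (s + 1)) := fun k hk => by
        have := hK k hk
        have := hi k hk
        grind
      induction H with
      | zero =>
        refine ((ih 0 (by omega)).sub ((ih 0 (by omega)).rowShift hi)).congr (fun k hk m => ?_)
          fun M => oddLimit_succ_zero _ M
        exact partCount_oddHook_succ_zero (by have := hK k hk; omega) (hp k hk) m
      | succ H ihH =>
        refine (((ih (H + 1) (by omega)).add (ihH.rowShift hi)).sub
          ((ih (H + 1) (by omega)).rowShift hi)).congr (fun k hk m => ?_)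
          fun M => oddLimit_succ_succ _ H M
        exact partCount_oddHook_succ_succ (by have := hK k hk; omega) (hp k hk) H m

end OddPatterns

section DistinctPatterns

open intervalIntegral

/-- The beta-type integral giving the asymptotic proportions for partitions into distinct parts. -/
noncomputable def betaHalf (a b : ℕ) : ℝ := ∫ x in (0 : ℝ)..1, x ^ a * ((1 + x)⁻¹) ^ b

lemma one_add_pos_of_mem {x : ℝ} (hx : x ∈ Set.uIcc (0 : ℝ) 1) : 0 < 1 + x := by
  rw [Set.uIcc_of_le zero_le_one, Set.mem_Icc] at hx
  linarith

lemma continuousOn_betaHalf (a b : ℕ) :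
    ContinuousOn (fun x : ℝ => x ^ a * ((1 + x)⁻¹) ^ b) (Set.uIcc 0 1) :=
  (continuousOn_pow a).mul
    (((continuousOn_const.add continuousOn_id).inv₀ fun _ hx => (one_add_pos_of_mem hx).ne').pow b)

lemma intervalIntegrable_betaHalf (a b : ℕ) :
    IntervalIntegrable (fun x : ℝ => x ^ a * ((1 + x)⁻¹) ^ b) MeasureTheory.volume 0 1 :=
  (continuousOn_betaHalf a b).intervalIntegrable

lemma betaHalf_zero (a : ℕ) : betaHalf a 0 = 1 / (a + 1) := by
  simp [betaHalf, integral_pow]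

lemma betaHalf_add (a b : ℕ) :
    betaHalf a (b + 1) + betaHalf (a + 1) (b + 1) = betaHalf a b := by
  rw [betaHalf, betaHalf, betaHalf, ← integral_add (intervalIntegrable_betaHalf _ _)
    (intervalIntegrable_betaHalf _ _)]
  refine integral_congr fun x hx => ?_
  have := one_add_pos_of_mem hx
  simp only [pow_succ]
  field_simp

lemma betaHalf_nonneg (a b : ℕ) : 0 ≤ betaHalf a b :=
  integral_nonneg zero_le_one fun x hx => by
    have := hx.1
    positivity

lemma betaHalf_le (a b : ℕ) : betaHalf a b ≤ 1 / (a + 1) := by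
  induction b with
  | zero => exact (betaHalf_zero a).le
  | succ b ih =>
    have := betaHalf_add a b
    have := betaHalf_nonneg (a + 1) (b + 1)
    linarith

/-- The multisets that, with one part `k` added, have distinct parts and a hook of length
`s + 1 + H` whose row has length `k` and whose arm is `s`. -/
def DistinctHook (s H k : ℕ) (m : Multiset ℕ) : Prop :=
  m.Nodup ∧ k ∉ m ∧ windowCount s k m = H

/-- The asymptotic proportion of the patterns `DistinctHook s H`. -/
noncomputable def distinctLimit (s H M : ℕ) : ℝ := s.choose H * betaHalf (M + H) (s + 1)

lemma partCount_split_notMem (Φ : Multiset ℕ → Prop) {p : ℕ} (hp : 1 ≤ p)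
    (hcons : ∀ m, Φ (p ::ₘ m) ↔ p ∉ m ∧ Φ m) (n : ℕ) :
    partCount Φ n = partCount (fun m => p ∉ m ∧ Φ m) n +
      if p ≤ n then partCount (fun m => p ∉ m ∧ Φ m) (n - p) else 0 := by
  rw [partCount_split Φ hp, partCount_congr hcons]

lemma partCount_le_distinctsCount {Φ : Multiset ℕ → Prop} (hΦ : ∀ m, Φ m → m.Nodup) (n : ℕ) :
    partCount Φ n ≤ distinctsCount n := by
  rw [← partCount_nodup]
  exact partCount_mono hΦ n

lemma distinctHook_cons {s H k : ℕ} (hs : s + 2 ≤ k) (m : Multiset ℕ) :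
    DistinctHook s H k ((k - (s + 1)) ::ₘ m) ↔ k - (s + 1) ∉ m ∧ DistinctHook s H k m := by
  rw [DistinctHook, windowCount_cons_of_add_lt (by omega), DistinctHook, Multiset.nodup_cons,
    Multiset.mem_cons, or_iff_right (by omega), and_assoc]

lemma distinctHook_succ_cons {s H k : ℕ} (hs : s + 2 ≤ k) (m : Multiset ℕ) :
    DistinctHook (s + 1) (H + 1) k ((k - (s + 1)) ::ₘ m) ↔
      k - (s + 1) ∉ m ∧ DistinctHook s H k m := by
  rw [DistinctHook, windowCount_succ_cons (by omega), DistinctHook, Multiset.nodup_cons,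
    Multiset.mem_cons, or_iff_right (by omega), and_assoc]
  refine and_congr_right fun h => ?_
  rw [windowCount_succ_of_notMem h, Nat.succ_inj]

lemma not_distinctHook_succ_zero_cons {s k : ℕ} (hs : s + 2 ≤ k) (m : Multiset ℕ) :
    ¬ DistinctHook (s + 1) 0 k ((k - (s + 1)) ::ₘ m) := by
  rw [DistinctHook, windowCount_succ_cons (by omega)]
  omega

lemma notMem_and_distinctHook_succ (s H k : ℕ) (m : Multiset ℕ) :
    k - (s + 1) ∉ m ∧ DistinctHook (s + 1) H k m ↔ k - (s + 1) ∉ m ∧ DistinctHook s H k m := by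
  refine and_congr_right fun h => ?_
  rw [DistinctHook, windowCount_succ_of_notMem h, DistinctHook]

lemma partCount_distinctHook_succ_zero {s k : ℕ} (hs : s + 2 ≤ k) (n : ℕ) :
    partCount (DistinctHook (s + 1) 0 k) n =
      partCount (fun m => k - (s + 1) ∉ m ∧ DistinctHook s 0 k m) n := by
  rw [partCount_split (DistinctHook (s + 1) 0 k) (p := k - (s + 1)) (by omega),
    partCount_congr (notMem_and_distinctHook_succ s 0 k),
    partCount_eq_zero (not_distinctHook_succ_zero_cons hs)]
  simp

lemma partCount_distinctHook_succ_succ {s k : ℕ} (hs : s + 2 ≤ k) (H n : ℕ) :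
    (partCount (DistinctHook (s + 1) (H + 1) k) n : ℝ) =
      partCount (fun m => k - (s + 1) ∉ m ∧ DistinctHook s (H + 1) k m) n +
      rowShift (s + 1) (fun k m =>
        (partCount (fun m => k - (s + 1) ∉ m ∧ DistinctHook s H k m) m : ℝ)) k n := by
  rw [partCount_split (DistinctHook (s + 1) (H + 1) k) (p := k - (s + 1)) (by omega),
    partCount_congr (notMem_and_distinctHook_succ s (H + 1) k),
    partCount_congr (distinctHook_succ_cons hs), rowShift]
  split_ifs <;> simp

variable {K : ℕ → Prop} {S : ℕ}

lemma RowAsymptotic.of_partCount_split {i C a b : ℕ} {Φ Ψ : ℕ → Multiset ℕ → Prop}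
    (hK : ∀ k, K k → i ≤ k)
    (hbase : RowAsymptotic K (fun _ m => (distinctsCount m : ℝ)) (fun M => betaHalf M 0))
    (hΦ : ∀ k m, Φ k m → m.Nodup)
    (hΨ : RowAsymptotic K (fun k m => (partCount (Ψ k) m : ℝ)) (fun M => C * betaHalf (M + a) b))
    (hsplit : ∀ k, K k → ∀ n, partCount (Ψ k) n = partCount (Φ k) n +
      if k - i ≤ n then partCount (Φ k) (n - (k - i)) else 0) :
    RowAsymptotic K (fun k m => (partCount (Φ k) m : ℝ))
      (fun M => C * betaHalf (M + a) (b + 1)) := by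
  refine RowAsymptotic.of_add_rowShift (C := C) hK hΨ (fun k hk m => ?_) hbase
    (fun _ _ _ => Nat.cast_nonneg _)
    (fun k _ m => by exact_mod_cast partCount_le_distinctsCount (hΦ k) m)
    (fun M => betaHalf_le M 0) (fun M => ?_) fun M => ?_
  · rw [hsplit k hk, _root_.rowShift]
    push_cast
    rfl
  · rw [← mul_add, add_right_comm M 1 a, betaHalf_add]
  · rw [abs_of_nonneg (mul_nonneg (Nat.cast_nonneg _) (betaHalf_nonneg _ _)), ← mul_one_div]
    refine mul_le_mul_of_nonneg_left ((betaHalf_le _ _).trans ?_) (Nat.cast_nonneg _)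
    exact one_div_le_one_div_of_le (by positivity) (by push_cast; linarith)

lemma rowAsymptotic_notMem_distinctHook {s : ℕ} (hK : ∀ k, K k → S + 1 ≤ k) (hs : s + 1 ≤ S)
    (hbase : RowAsymptotic K (fun _ m => (distinctsCount m : ℝ)) (fun M => betaHalf M 0)) (H : ℕ)
    (hD : RowAsymptotic K (fun k m => (partCount (DistinctHook s H k) m : ℝ))
      (distinctLimit s H)) :
    RowAsymptotic K
      (fun k m => (partCount (fun m => k - (s + 1) ∉ m ∧ DistinctHook s H k m) m : ℝ))
      (fun M => s.choose H * betaHalf (M + H) (s + 2)) := by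
  refine RowAsymptotic.of_partCount_split (i := s + 1)
    (Φ := fun k m => k - (s + 1) ∉ m ∧ DistinctHook s H k m)
    (fun k hk => by have := hK k hk; omega) hbase (fun k m h => h.2.1) hD fun k hk n => ?_
  have := hK k hk
  exact partCount_split_notMem _ (by omega) (distinctHook_cons (by omega)) n

lemma rowAsymptotic_distinctHook (hK : ∀ k, K k → S + 1 ≤ k)
    (hbase : RowAsymptotic K (fun _ m => (distinctsCount m : ℝ)) (fun M => betaHalf M 0))
    (s H : ℕ) (hs : s ≤ S) :
    RowAsymptotic K (fun k m => (partCount (DistinctHook s H k) m : ℝ)) (distinctLimit s H) := by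
  induction s generalizing H with
  | zero =>
    cases H with
    | zero =>
      have h := RowAsymptotic.of_partCount_split (i := 0) (C := 1) (a := 0) (b := 0)
        (Φ := fun k m => k ∉ m ∧ m.Nodup) (Ψ := fun _ m => m.Nodup) (fun _ _ => Nat.zero_le _)
        hbase (fun k m h => h.2) (hbase.congr (fun k _ m => by rw [partCount_nodup]) (by simp))
        (fun k hk n => partCount_split_notMem _ (by have := hK k hk; omega)
          (fun m => Multiset.nodup_cons) n)
      refine h.congr (fun k _ m => ?_) fun M => by simp [distinctLimit]
      rw [partCount_congr fun m => ?_]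
      simp [DistinctHook, windowCount_zero, and_comm]
    | succ H =>
      refine rowAsymptotic_zero.congr (fun k _ m => ?_) fun M => by simp [distinctLimit]
      rw [partCount_eq_zero fun m h => ?_, Nat.cast_zero]
      simpa [windowCount_zero] using h.2.2
  | succ s ih =>
    have hi : ∀ k, K k → s + 1 ≤ k := fun k hk => by have := hK k hk; omega
    have hN := fun H => rowAsymptotic_notMem_distinctHook hK hs hbase H (ih H (by omega))
    cases H with
    | zero =>
      refine (hN 0).congr (fun k hk m => ?_) fun M => by simp [distinctLimit]
      rw [partCount_distinctHook_succ_zero (by have := hK k hk; omega)]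
    | succ H =>
      refine ((hN (H + 1)).add ((hN H).rowShift hi)).congr (fun k hk m => ?_) fun M => ?_
      · exact partCount_distinctHook_succ_succ (by have := hK k hk; omega) H m
      · rw [distinctLimit, Nat.choose_succ_succ, show M + 1 + H = M + (H + 1) by ring]
        push_cast
        ring

end DistinctPatterns

section Constants

/-- The limit of `hookOdd h n / distinctsSum n`. -/
noncomputable def hookOddLimit (h : ℕ) : ℝ := ∑ s ∈ range h, oddLimit (s / 2) (h - 1 - s) 0

/-- The limit of `hookDistinct h n / distinctsSum n`. -/
noncomputable def hookDistinctLimit (h : ℕ) : ℝ := ∑ s ∈ range h, distinctLimit s (h - 1 - s) 0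

lemma four_mul_sum_div_two (h : ℕ) :
    4 * ∑ s ∈ range h, (s / 2 + (h - 1 - s) + 1) = 3 * h ^ 2 + h % 2 := by
  induction h with
  | zero => simp
  | succ h ih =>
    have hs : ∑ s ∈ range h, (s / 2 + (h + 1 - 1 - s) + 1) =
        ∑ s ∈ range h, (s / 2 + (h - 1 - s) + 1) + h := by
      rw [sum_congr rfl fun s hs => show _ = (s / 2 + (h - 1 - s) + 1) + 1 by
        have := mem_range.1 hs
        omega, sum_add_distrib]
      simp
    rw [sum_range_succ, hs, mul_add, mul_add, ih, add_sq]
    omega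

lemma lt_hookOddLimit {h : ℕ} (hh : 2 ≤ h) : (3 / 5 : ℝ) < hookOddLimit h := by
  have h2 : (2 : ℝ) ≤ h := by exact_mod_cast hh
  have hsum : (∑ s ∈ range h, ((s / 2 : ℕ) + (h - 1 - s : ℕ) + 1 : ℝ)) ≤ (3 * h ^ 2 + 1) / 4 := by
    have h1 : 4 * ∑ s ∈ range h, (s / 2 + (h - 1 - s) + 1) ≤ 3 * h ^ 2 + 1 := by
      rw [four_mul_sum_div_two]
      omega
    have h1' : (4 : ℝ) * ∑ s ∈ range h, ((s / 2 : ℕ) + (h - 1 - s : ℕ) + 1 : ℝ) ≤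
        3 * h ^ 2 + 1 := by exact_mod_cast h1
    linarith
  have hterm : ∀ s ∈ range h, 4 / (3 * h) - 8 / (9 * h ^ 2) *
      ((s / 2 : ℕ) + (h - 1 - s : ℕ) + 1 : ℝ) ≤ oddLimit (s / 2) (h - 1 - s) 0 := fun s _ => by
    rw [oddLimit_at_zero]
    have hy : (0 : ℝ) < (s / 2 : ℕ) + (h - 1 - s : ℕ) + 1 := by positivity
    generalize ((s / 2 : ℕ) + (h - 1 - s : ℕ) + 1 : ℝ) = y at hy
    rw [← sub_nonneg, show 1 / (2 * y) - (4 / (3 * h) - 8 / (9 * h ^ 2) * y) =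
      (4 * y - 3 * h) ^ 2 / (18 * h ^ 2 * y) by field_simp; ring]
    positivity
  refine lt_of_lt_of_le ?_ (sum_le_sum hterm)
  rw [sum_sub_distrib, ← mul_sum, sum_const, card_range, nsmul_eq_mul]
  refine lt_of_lt_of_le ?_ (sub_le_sub_left (mul_le_mul_of_nonneg_left hsum (by positivity)) _)
  rw [show (h : ℝ) * (4 / (3 * h)) - 8 / (9 * h ^ 2) * ((3 * h ^ 2 + 1) / 4) =
    2 / 3 - 2 / (9 * h ^ 2) by field_simp; ring, lt_sub_comm, div_lt_iff₀ (by positivity)]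
  nlinarith

/-- The integrand whose integral over the unit interval is `hookDistinctLimit (n + 1)`. -/
noncomputable def hookDensity (n : ℕ) (x : ℝ) : ℝ :=
  ∑ p ∈ antidiagonal n, p.1.choose p.2 * (x ^ p.2 * ((1 + x)⁻¹) ^ (p.1 + 1))

lemma hookDensity_succ_succ (n : ℕ) (x : ℝ) : hookDensity (n + 2) x =
    (1 + x)⁻¹ * hookDensity (n + 1) x + x * (1 + x)⁻¹ * hookDensity n x := by
  simp only [hookDensity]
  rw [Nat.antidiagonal_succ, sum_cons, sum_map, Nat.antidiagonal_succ', sum_cons, sum_map,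
    sum_cons, sum_map]
  simp only [Function.Embedding.prodMap, Function.Embedding.coeFn_mk, Prod.map,
    Function.Embedding.refl_apply, Nat.choose_succ_succ, Nat.choose_zero_right,
    Nat.succ_eq_add_one, mul_add, mul_sum, Nat.cast_add, add_mul, sum_add_distrib,
    Nat.choose_zero_succ]
  simp only [pow_succ, pow_zero, Nat.cast_one, Nat.cast_zero]
  ring_nf

lemma hookDensity_one (x : ℝ) : hookDensity 1 x = ((1 + x)⁻¹) ^ 2 := by
  simp [hookDensity, Nat.antidiagonal_succ]

lemma hookDensity_two (x : ℝ) :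
    hookDensity 2 x = ((1 + x)⁻¹) ^ 3 + x * ((1 + x)⁻¹) ^ 2 := by
  simp [hookDensity, Nat.antidiagonal_succ]
  ring

lemma hookDensity_two_le {x : ℝ} (hx0 : 0 ≤ x) (hx1 : x ≤ 1) :
    hookDensity 2 x ≤ 1 - 6 / 5 * x + 3 / 5 * x ^ 2 := by
  rw [hookDensity_two, show ((1 + x)⁻¹) ^ 3 + x * ((1 + x)⁻¹) ^ 2 =
    (1 + x + x ^ 2) / (1 + x) ^ 3 by field_simp; ring, div_le_iff₀ (by positivity)]
  have : 0 ≤ x * (4 - 5 * x - 4 * x ^ 2 + 3 * x ^ 3 + 3 * x ^ 4) := by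
    refine mul_nonneg hx0 ?_
    nlinarith [sq_nonneg (x ^ 2 + x / 2 - 1), sq_nonneg (x - 3 / 4), sq_nonneg (x ^ 2 - 3 / 5)]
  linarith

lemma hookDensity_succ_le {x : ℝ} (hx : 0 ≤ x) (n : ℕ) :
    hookDensity (n + 1) x ≤ hookDensity 2 x := by
  have hy : (1 + x)⁻¹ + x * (1 + x)⁻¹ = 1 := by field_simp
  induction n using Nat.twoStepInduction with
  | zero =>
    rw [zero_add, hookDensity_one, hookDensity_two,
      show ((1 + x)⁻¹) ^ 3 + x * ((1 + x)⁻¹) ^ 2 =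
        ((1 + x)⁻¹) ^ 2 * ((1 + x)⁻¹ + x) by ring]
    refine le_mul_of_one_le_right (by positivity) ?_
    rw [← sub_nonneg, show (1 + x)⁻¹ + x - 1 = x ^ 2 * (1 + x)⁻¹ by field_simp; ring]
    positivity
  | one => exact le_rfl
  | more n ih1 ih2 =>
    rw [hookDensity_succ_succ]
    calc _ ≤ (1 + x)⁻¹ * hookDensity 2 x + x * (1 + x)⁻¹ * hookDensity 2 x := by gcongr
      _ = hookDensity 2 x := by rw [← add_mul, hy, one_mul]

open intervalIntegral in
lemma hookDistinctLimit_succ (n : ℕ) :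
    hookDistinctLimit (n + 1) = ∫ x in (0 : ℝ)..1, hookDensity n x := by
  simp only [hookDensity]
  rw [integral_finsetSum fun p _ => (intervalIntegrable_betaHalf _ _).const_mul _,
    Nat.sum_antidiagonal_eq_sum_range_succ_mk, hookDistinctLimit]
  simp [distinctLimit, betaHalf]

lemma intervalIntegrable_hookDensity (n : ℕ) :
    IntervalIntegrable (hookDensity n) MeasureTheory.volume 0 1 :=
  (continuousOn_finsetSum _ fun p _ =>
    continuousOn_const.mul (continuousOn_betaHalf p.2 (p.1 + 1))).intervalIntegrable

open intervalIntegral in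
lemma hookDistinctLimit_le {h : ℕ} (hh : 2 ≤ h) : hookDistinctLimit h ≤ 3 / 5 := by
  obtain ⟨n, rfl⟩ := Nat.exists_eq_add_of_le' hh
  rw [hookDistinctLimit_succ]
  calc _ ≤ ∫ x in (0 : ℝ)..1, (1 - 6 / 5 * x + 3 / 5 * x ^ 2) := by
        refine integral_mono_on zero_le_one (intervalIntegrable_hookDensity _)
          (Continuous.intervalIntegrable (by fun_prop) _ _) fun x hx => ?_
        exact (hookDensity_succ_le hx.1 n).trans (hookDensity_two_le hx.1 hx.2)
    _ = 3 / 5 := by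
        rw [integral_add (Continuous.intervalIntegrable (by fun_prop) _ _)
          (Continuous.intervalIntegrable (by fun_prop) _ _),
          integral_sub (Continuous.intervalIntegrable (by fun_prop) _ _)
          (Continuous.intervalIntegrable (by fun_prop) _ _)]
        simp only [integral_const, integral_const_mul, integral_pow,
          integral_const_mul (6 / 5 : ℝ) fun x : ℝ => x, _root_.integral_id]
        norm_num

lemma hookDistinctLimit_pos {h : ℕ} (hh : 1 ≤ h) : 0 < hookDistinctLimit h := by
  refine sum_pos' (fun s _ => mul_nonneg (Nat.cast_nonneg _) (betaHalf_nonneg _ _))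
    ⟨h - 1, mem_range.2 (by omega), ?_⟩
  rw [distinctLimit, Nat.sub_self, Nat.choose_zero_right, Nat.cast_one, one_mul, betaHalf]
  refine intervalIntegral.intervalIntegral_pos_of_pos_on (intervalIntegrable_betaHalf _ _)
    (fun x hx => ?_) one_pos
  have := hx.1
  positivity

end Constants

section HookAsymptotics

open Filter Topology

open Classical in
lemma sum_Icc_eq_rowSum {K : ℕ → Prop} {s : ℕ} {X : ℕ → ℕ → ℝ} {Y : ℕ → ℕ → ℕ}
    (hK : ∀ k, K k → s + 1 ≤ k) (hX : ∀ k, K k → ∀ m, (Y k m : ℝ) = X k m)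
    (h0 : ∀ k, s + 1 ≤ k → ¬ K k → ∀ m, Y k m = 0) (n : ℕ) :
    ((∑ k ∈ Icc (s + 1) n, Y k (n - k) : ℕ) : ℝ) = rowSum K X (0 + 1) 0 n := by
  rw [rowSum, Nat.cast_sum]
  simp only [zero_add, one_mul, add_zero]
  symm
  refine sum_subset_zero_on_sdiff (fun k hk => ?_) (fun k hk => ?_) fun k hk => ?_
  · rw [mem_filter] at hk
    exact mem_Icc.2 ⟨hK k hk.2.1, hk.2.2⟩
  · rw [Finset.mem_sdiff, mem_Icc, mem_filter, mem_range] at hk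
    rw [h0 k hk.1.1 fun h => hk.2 ⟨by omega, h, hk.1.2⟩, Nat.cast_zero]
  · exact (hX k (mem_filter.1 hk).2.1 _).symm

lemma tendsto_hookDistinct_div (h : ℕ) :
    Tendsto (fun n => (hookDistinct h n : ℝ) / distinctsSum n) atTop
      (𝓝 (hookDistinctLimit h)) := by
  have hsum : ∀ n, (hookDistinct h n : ℝ) = ∑ s ∈ range h, rowSum (fun k => s + 1 ≤ k)
      (fun k m => (partCount (DistinctHook s (h - 1 - s) k) m : ℝ)) (0 + 1) 0 n := fun n => by
    have h1 : hookDistinct h n = _ := (sum_congr (by ext; simp [Nat.Partition.distincts])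
      fun _ _ => rfl).trans (sum_hookCount_eq Multiset.Nodup h n)
    rw [h1, Nat.cast_sum]
    refine sum_congr rfl fun s _ => ?_
    refine sum_Icc_eq_rowSum (fun _ hk => hk) (fun k hk m => ?_)
      (fun _ hk hk' => absurd hk hk') n
    · rw [partCount_congr fun m => ?_]
      rw [DistinctHook, Multiset.nodup_cons]
      grind [Multiset.count_eq_zero]
  simp only [hsum, sum_div]
  refine tendsto_finsetSum _ fun s _ => ?_
  refine rowAsymptotic_distinctHook (S := s) (fun _ hk => hk) ?_ s _ le_rfl 0 0
  refine (rowAsymptotic_distinctsCount (b := s + 1) one_pos fun k => ?_).congr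
    (fun _ _ _ => rfl) fun M => ?_
  · rw [le_iff_exists_add]
    simp
  · rw [betaHalf_zero]
    simp

lemma tendsto_hookOdd_div (h : ℕ) :
    Tendsto (fun n => (hookOdd h n : ℝ) / distinctsSum n) atTop (𝓝 (hookOddLimit h)) := by
  have hsum : ∀ n, (hookOdd h n : ℝ) = ∑ s ∈ range h, rowSum (fun k => s + 1 ≤ k ∧ ¬ Even k)
      (fun k m => (partCount (OddHook s (h - 1 - s) k) m : ℝ)) (0 + 1) 0 n := fun n => by
    have h1 : hookOdd h n = _ := (sum_congr (by
      ext; simp [Nat.Partition.odds, Nat.Partition.restricted])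
      fun _ _ => rfl).trans (sum_hookCount_eq (fun m => ∀ i ∈ m, ¬ Even i) h n)
    rw [h1, Nat.cast_sum]
    refine sum_congr rfl fun s _ => ?_
    refine sum_Icc_eq_rowSum (fun _ hk => hk.1) (fun k hk m => ?_)
      (fun k hk hk' m => ?_) n
    · rw [partCount_congr fun m => ?_]
      simp [OddHook, Nat.not_even_iff_odd.1 hk.2]
    · refine partCount_eq_zero (fun m hm => hk' ⟨hk, hm.1 k (Multiset.mem_cons_self k m)⟩) m
  simp only [hsum, sum_div]
  refine tendsto_finsetSum _ fun s _ => ?_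
  refine rowAsymptotic_oddHook (S := s) (fun _ hk => hk) ?_ s _ le_rfl 0 0
  refine (rowAsymptotic_distinctsCount (b := s + 1 + (s + 1 + 1) % 2) two_pos fun k => ?_).congr
    (fun _ _ _ => rfl) fun M => oddLimit_zero_zero M
  constructor
  · rintro ⟨h1, h2⟩
    exact ⟨(k - (s + 1)) / 2, by grind⟩
  · rintro ⟨t, rfl⟩
    grind

end HookAsymptotics

/-- For each `h ≥ 2` there is a constant `γ_h > 1` with `a_h(n)/b_h(n) → γ_h`;
in particular there is an integer `N_h > 0` with `a_h(n) ≥ b_h(n)` for all `n > N_h`. -/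
theorem hookOdd_div_hookDistinct_tendsto (h : ℕ) (hh : 2 ≤ h) :
    ∃ γ : ℝ, 1 < γ ∧
      Filter.Tendsto (fun n : ℕ => (hookOdd h n : ℝ) / (hookDistinct h n : ℝ))
        Filter.atTop (nhds γ) ∧
      ∃ N : ℕ, 0 < N ∧ ∀ n : ℕ, N < n → hookDistinct h n ≤ hookOdd h n := by
  have hβ := hookDistinctLimit_pos (show 1 ≤ h by omega)
  have hγ : 1 < hookOddLimit h / hookDistinctLimit h :=
    (one_lt_div hβ).2 ((hookDistinctLimit_le hh).trans_lt (lt_hookOddLimit hh))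
  have hlim : Filter.Tendsto (fun n : ℕ => (hookOdd h n : ℝ) / hookDistinct h n) Filter.atTop
      (nhds (hookOddLimit h / hookDistinctLimit h)) := by
    refine ((tendsto_hookOdd_div h).div (tendsto_hookDistinct_div h) hβ.ne').congr fun n => ?_
    exact div_div_div_cancel_right₀ (distinctsSum_pos n).ne' _ _
  refine ⟨_, hγ, hlim, ?_⟩
  obtain ⟨N, hN⟩ := Filter.eventually_atTop.1 (hlim.eventually_const_lt hγ)
  refine ⟨N + 1, N.succ_pos, fun n hn => ?_⟩
  have hn1 := hN n (by omega)
  rcases Nat.eq_zero_or_pos (hookDistinct h n) with h0 | h0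
  · omega
  · rw [one_lt_div (by exact_mod_cast h0)] at hn1
    exact_mod_cast hn1.le
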